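/- Let p be prime, n ≥ 1, m ≥ 1, let α, α₁, …, α_m be real numbers, and let 1 < r, r₁, …, r_m, q, q₁, …, q_m < ∞ satisfy α₁ + ⋯ + α_m = α, 1/r₁ + ⋯ + 1/r_m = 1/r, and 1/q₁ + ⋯ + 1/q_m = 1/q. Let ψ be a nonnegative measurable function on (ℤ_p^*)^m and set A = ∫_{(ℤ_p^*)^m} |t₁|_p^{-(α₁+n/q₁)} ⋯ |t_m|_p^{-(α_m+n/q_m)} ψ(t₁,…,t_m) dt₁⋯dt_m. If A < ∞, then for all nonnegative measurable functions f₁, …, f_m on ℚ_p^n one has ‖H^{p,m}_ψ(f₁,…,f_m)‖_{K̇^{α,r}_q} ≤ A · ∏_{i=1}^m ‖f_i‖_{K̇^{α_i,r_i}_{q_i}}; in particular H^{p,m}_ψ is bounded from K̇^{α₁,r₁}_{q₁}(ℚ_p^n) × ⋯ × K̇^{α_m,r_m}_{q_m}(ℚ_p^n) to K̇^{α,r}_q(ℚ_p^n) with operator norm at most A. -/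

import Mathlib

open MeasureTheory
open scoped ENNReal

noncomputable section

variable (p : ℕ) [Fact p.Prime]

instance padicMeasurableSpace : MeasurableSpace ℚ_[p] := borel _
instance padicBorelSpace : BorelSpace ℚ_[p] := ⟨rfl⟩

/-- The closed unit ball of `ℚ_[p]` as a positive compact set. -/
def padicUnitBall : TopologicalSpace.PositiveCompacts ℚ_[p] where
  carrier := Metric.closedBall 0 1
  isCompact' := isCompact_closedBall 0 1
  interior_nonempty' :=
    ⟨0, mem_interior_iff_mem_nhds.mpr
      (Filter.mem_of_superset (Metric.ball_mem_nhds 0 one_pos) Metric.ball_subset_closedBall)⟩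

/-- Haar measure on `ℚ_[p]` normalized so that `ℤ_p` has measure 1. -/
def padicHaar : Measure ℚ_[p] := Measure.addHaarMeasure (padicUnitBall p)

instance : SigmaFinite (padicHaar p) := by
  unfold padicHaar; infer_instance

/-- Normalized Haar measure on `ℚ_[p]^n` (the product measure), for which the
unit ball has measure 1. -/
def padicHaarPi (n : ℕ) : Measure (Fin n → ℚ_[p]) := Measure.pi fun _ => padicHaar p

/-- `ℤ_p^* = {t : 0 < |t|_p ≤ 1}`. -/
def Zpstar : Set ℚ_[p] := {t | t ≠ 0 ∧ ‖t‖ ≤ 1}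

/-- `(ℤ_p^*)^m`. -/
def ZpstarPi (m : ℕ) : Set (Fin m → ℚ_[p]) := Set.univ.pi fun _ => Zpstar p

/-- The sphere `S_k = {x ∈ ℚ_p^n : |x|_p = p^k}`. -/
def padicSphere (n : ℕ) (k : ℤ) : Set (Fin n → ℚ_[p]) := {x | ‖x‖ = (p : ℝ) ^ k}

/-- `‖f χ_k‖_{L^q}` for a nonnegative (ℝ≥0∞-valued) function. -/
def lqNormSphere (n : ℕ) (q : ℝ) (k : ℤ) (f : (Fin n → ℚ_[p]) → ℝ≥0∞) : ℝ≥0∞ :=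
  (∫⁻ x in padicSphere p n k, f x ^ q ∂ padicHaarPi p n) ^ (1 / q)

/-- The homogeneous p-adic Herz norm `‖f‖_{K̇^{α,r}_q}`. -/
def herzNorm (n : ℕ) (α r q : ℝ) (f : (Fin n → ℚ_[p]) → ℝ≥0∞) : ℝ≥0∞ :=
  (∑' k : ℤ, (p : ℝ≥0∞) ^ ((k : ℝ) * α * r) * lqNormSphere p n q k f ^ r) ^ (1 / r)

/-- The homogeneous p-adic Morrey–Herz norm `‖f‖_{MK̇^{α,λ}_{r,q}}`. -/
def morreyHerzNorm (n : ℕ) (α lam r q : ℝ) (f : (Fin n → ℚ_[p]) → ℝ≥0∞) : ℝ≥0∞ :=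
  ⨆ k₀ : ℤ, (p : ℝ≥0∞) ^ (-(k₀ : ℝ) * lam) *
    (∑' k : {k : ℤ // k ≤ k₀},
      (p : ℝ≥0∞) ^ (((k : ℤ) : ℝ) * α * r) * lqNormSphere p n q (k : ℤ) f ^ r) ^ (1 / r)

/-- The weighted multilinear p-adic Hardy operator `H^{p,m}_ψ`. -/
def multilinearHardy (n m : ℕ) (ψ : (Fin m → ℚ_[p]) → ℝ≥0∞)
    (f : Fin m → (Fin n → ℚ_[p]) → ℝ≥0∞) (x : Fin n → ℚ_[p]) : ℝ≥0∞ :=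
  ∫⁻ t in ZpstarPi p m, (∏ i, f i (t i • x)) * ψ t ∂ padicHaarPi p m

/-- The dual weighted multilinear p-adic Hardy operator `H^{p,m,*}_ψ`. -/
def multilinearHardyDual (n m : ℕ) (ψ : (Fin m → ℚ_[p]) → ℝ≥0∞)
    (f : Fin m → (Fin n → ℚ_[p]) → ℝ≥0∞) (x : Fin n → ℚ_[p]) : ℝ≥0∞ :=
  ∫⁻ t in ZpstarPi p m,
      (∏ i, f i ((((padicNormE (t i) : ℚ)⁻¹ : ℚ_[p])) • x)) *
        (∏ i, ENNReal.ofReal ‖t i‖ ^ (-(n : ℝ))) * ψ t ∂ padicHaarPi p m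


open Filter Topology
open scoped Pointwise

theorem closedBall_zero_one_eq_iUnion_ball :
    Metric.closedBall (0 : ℚ_[p]) 1 = ⋃ j : Fin p, Metric.ball ((j : ℕ) : ℚ_[p]) 1 := by
  ext x
  simp only [Metric.mem_closedBall, dist_eq_norm, sub_zero, Set.mem_iUnion, Metric.mem_ball]
  constructor
  · intro hx
    obtain ⟨y, rfl⟩ : ∃ y : ℤ_[p], (y : ℚ_[p]) = x := ⟨⟨x, hx⟩, rfl⟩
    refine ⟨⟨y.zmodRepr, PadicInt.zmodRepr_lt_p y⟩, ?_⟩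
    have h := PadicInt.norm_sub_zmodRepr_lt_one y
    rwa [PadicInt.norm_def, PadicInt.coe_sub, PadicInt.coe_natCast] at h
  · rintro ⟨j, hj⟩
    have h1 : ‖((j : ℕ) : ℚ_[p])‖ ≤ 1 := by
      simpa using Padic.norm_int_le_one (p := p) ((j : ℕ) : ℤ)
    calc ‖x‖ = ‖(x - (j : ℕ)) + (j : ℕ)‖ := by simp
      _ ≤ max ‖x - (j : ℕ)‖ ‖((j : ℕ) : ℚ_[p])‖ := Padic.nonarchimedean _ _
      _ ≤ 1 := max_le hj.le h1

theorem pairwise_disjoint_ball_natCast :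
    Pairwise (Function.onFun Disjoint fun j : Fin p => Metric.ball ((j : ℕ) : ℚ_[p]) 1) := by
  intro i j hij
  rw [Function.onFun, Set.disjoint_left]
  intro x hi hj
  apply hij
  rw [Metric.mem_ball, dist_eq_norm] at hi hj
  have h : ‖(((i : ℕ) - (j : ℕ) : ℤ) : ℚ_[p])‖ < 1 := by
    push_cast
    calc ‖((i : ℕ) : ℚ_[p]) - (j : ℕ)‖
        = ‖(x - ((j : ℕ) : ℚ_[p])) - (x - ((i : ℕ) : ℚ_[p]))‖ := by congr 1; ring
      _ ≤ max ‖x - ((j : ℕ) : ℚ_[p])‖ ‖x - ((i : ℕ) : ℚ_[p])‖ := by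
        have h := Padic.nonarchimedean (x - ((j : ℕ) : ℚ_[p])) (-(x - ((i : ℕ) : ℚ_[p])))
        rwa [← sub_eq_add_neg, norm_neg] at h
      _ < 1 := max_lt hj hi
  rw [Padic.norm_intCast_lt_one_iff] at h
  have hi' := i.2
  have hj' := j.2
  obtain ⟨c, hc⟩ := h
  have : c = 0 := by
    by_contra hc0
    have h1 : (p : ℤ) ∣ (i : ℕ) - (j : ℕ) := ⟨c, hc⟩
    have := Int.eq_zero_of_abs_lt_dvd h1 (by rw [abs_lt]; omega)
    have hp : (p : ℤ) ≠ 0 := by exact_mod_cast (Fact.out : p.Prime).ne_zero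
    rw [this] at hc
    exact (mul_ne_zero hp hc0) hc.symm
  subst this
  ext
  omega

instance isAddHaarMeasure_padicHaar : (padicHaar p).IsAddHaarMeasure := by
  unfold padicHaar; infer_instance

instance regular_padicHaar : (padicHaar p).Regular := by
  unfold padicHaar; infer_instance

theorem padicHaar_closedBall_zero_one : padicHaar p (Metric.closedBall 0 1) = 1 :=
  Measure.addHaarMeasure_self (K₀ := padicUnitBall p)

theorem padicHaar_ball_one (a : ℚ_[p]) :
    padicHaar p (Metric.ball a 1) = padicHaar p (Metric.ball 0 1) := by
  rw [← measure_preimage_add (padicHaar p) a (Metric.ball a 1)]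
  congr 1
  ext x
  simp [Metric.mem_ball, dist_eq_norm]

theorem padicHaar_ball_zero_one : padicHaar p (Metric.ball 0 1) = (p : ℝ≥0∞)⁻¹ := by
  have h := padicHaar_closedBall_zero_one p
  rw [closedBall_zero_one_eq_iUnion_ball, measure_iUnion (pairwise_disjoint_ball_natCast p)
    (fun _ => Metric.isOpen_ball.measurableSet)] at h
  simp_rw [padicHaar_ball_one p] at h
  rw [tsum_fintype, Finset.sum_const, Finset.card_univ, Fintype.card_fin, nsmul_eq_mul,
    mul_comm] at h
  exact ENNReal.eq_inv_of_mul_eq_one_left h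

theorem closedBall_zero_inv_eq_ball :
    Metric.closedBall (0 : ℚ_[p]) (p : ℝ)⁻¹ = Metric.ball 0 1 := by
  ext x
  have := Padic.norm_le_pow_iff_norm_lt_pow_add_one x (-1)
  simpa using this

theorem units_smul_closedBall (u : ℚ_[p]ˣ) :
    u • Metric.closedBall (0 : ℚ_[p]) 1 = Metric.closedBall 0 ‖(u : ℚ_[p])‖ := by
  have h := smul_closedBall' (c := (u : ℚ_[p])) u.ne_zero (0 : ℚ_[p]) 1
  rwa [smul_zero, mul_one] at h

theorem distribHaarChar_eq_padicHaar (u : ℚ_[p]ˣ) :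
    (distribHaarChar ℚ_[p] u : ℝ≥0∞) = padicHaar p (Metric.closedBall 0 ‖(u : ℚ_[p])‖) := by
  rw [← units_smul_closedBall, ← distribHaarChar_mul (padicHaar p), padicHaar_closedBall_zero_one,
    mul_one]

theorem distribHaarChar_padic (u : ℚ_[p]ˣ) :
    distribHaarChar ℚ_[p] u = ‖(u : ℚ_[p])‖₊ := by
  have hp0 : (p : ℚ_[p]) ≠ 0 := by exact_mod_cast (Fact.out : p.Prime).ne_zero
  have hp : distribHaarChar ℚ_[p] (Units.mk0 (p : ℚ_[p]) hp0) = ‖(p : ℚ_[p])‖₊ := by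
    apply ENNReal.coe_injective
    rw [distribHaarChar_eq_padicHaar, Units.val_mk0, Padic.norm_p, closedBall_zero_inv_eq_ball,
      padicHaar_ball_zero_one, ← enorm_eq_nnnorm, ← ofReal_norm, Padic.norm_p,
      ENNReal.ofReal_inv_of_pos (by exact_mod_cast (Fact.out : p.Prime).pos),
      ENNReal.ofReal_natCast]
  have hv : ‖(u : ℚ_[p])‖
      = ‖((Units.mk0 (p : ℚ_[p]) hp0 ^ (u : ℚ_[p]).valuation : ℚ_[p]ˣ) : ℚ_[p])‖ := by
    rw [Padic.norm_eq_zpow_neg_valuation u.ne_zero]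
    simp
  have hw : distribHaarChar ℚ_[p] u
      = distribHaarChar ℚ_[p] (Units.mk0 (p : ℚ_[p]) hp0 ^ (u : ℚ_[p]).valuation) := by
    apply ENNReal.coe_injective
    rw [distribHaarChar_eq_padicHaar, distribHaarChar_eq_padicHaar, hv]
  rw [hw, map_zpow, hp]
  apply NNReal.coe_injective
  rw [coe_nnnorm, hv]
  simp

theorem padicHaar_preimage_mul {t : ℚ_[p]} (ht : t ≠ 0) (s : Set ℚ_[p]) :
    padicHaar p ((t * ·) ⁻¹' s) = (‖t‖₊ : ℝ≥0∞)⁻¹ * padicHaar p s := by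
  have h : (t * ·) ⁻¹' s = (Units.mk0 t ht)⁻¹ • s := by
    rw [← Set.preimage_smul]
    rfl
  rw [h, ← distribHaarChar_mul (padicHaar p), distribHaarChar_padic,
    Units.val_inv_eq_inv_val, Units.val_mk0, nnnorm_inv, ENNReal.coe_inv (by simpa using ht)]

theorem map_smul_padicHaarPi (n : ℕ) {t : ℚ_[p]} (ht : t ≠ 0) :
    (padicHaarPi p n).map (t • ·) = ((‖t‖₊ : ℝ≥0∞)⁻¹ ^ n) • padicHaarPi p n := by
  have h0 : (‖t‖₊ : ℝ≥0∞) ≠ 0 := by simpa using ht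
  have hm : Measurable fun x : Fin n → ℚ_[p] => t • x := measurable_const_smul t
  have key : padicHaarPi p n = ((‖t‖₊ : ℝ≥0∞) ^ n) • (padicHaarPi p n).map (t • ·) := by
    refine Measure.pi_eq fun s hs => ?_
    rw [Measure.smul_apply, Measure.map_apply hm (MeasurableSet.univ_pi hs)]
    have : (fun x : Fin n → ℚ_[p] => t • x) ⁻¹' Set.univ.pi s
        = Set.univ.pi fun i => (t * ·) ⁻¹' s i := by
      ext x; simp
    rw [this, padicHaarPi, Measure.pi_pi]
    simp_rw [padicHaar_preimage_mul p ht]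
    rw [Finset.prod_mul_distrib, Finset.prod_const, Finset.card_univ, Fintype.card_fin,
      smul_eq_mul, ← mul_assoc, ← mul_pow, ENNReal.mul_inv_cancel h0 ENNReal.coe_ne_top, one_pow,
      one_mul]
  conv_rhs => rw [key]
  rw [smul_smul, ← mul_pow, ENNReal.inv_mul_cancel h0 ENNReal.coe_ne_top, one_pow, one_smul]

theorem lintegral_comp_smul_padicHaarPi (n : ℕ) {t : ℚ_[p]} (ht : t ≠ 0)
    {g : (Fin n → ℚ_[p]) → ℝ≥0∞} (hg : Measurable g) :
    ∫⁻ x, g (t • x) ∂padicHaarPi p n = (‖t‖₊ : ℝ≥0∞)⁻¹ ^ n * ∫⁻ x, g x ∂padicHaarPi p n := by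
  rw [← lintegral_map hg (measurable_const_smul t), map_smul_padicHaarPi p n ht,
    lintegral_smul_measure, smul_eq_mul]

/-- **Minkowski's integral inequality** for `ℝ≥0∞`-valued functions. -/
theorem lintegral_rpow_lintegral_le {X T : Type*} [MeasurableSpace X] [MeasurableSpace T]
    (μ : Measure X) [SigmaFinite μ] (ν : Measure T) [SFinite ν] {q : ℝ} (hq : 1 < q)
    {F : X → T → ℝ≥0∞} (hF : Measurable (Function.uncurry F)) :
    (∫⁻ x, (∫⁻ t, F x t ∂ν) ^ q ∂μ) ^ (1 / q) ≤ ∫⁻ t, (∫⁻ x, F x t ^ q ∂μ) ^ (1 / q) ∂ν := by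
  have hq0 : 0 < q := by linarith
  set G : X → ℝ≥0∞ := fun x => ∫⁻ t, F x t ∂ν with hGdef
  have hG : Measurable G := hF.lintegral_prod_right'
  set R : ℝ≥0∞ := ∫⁻ t, (∫⁻ x, F x t ^ q ∂μ) ^ (1 / q) ∂ν
  set H : ℕ → X → ℝ≥0∞ := fun N => (spanningSets μ N).indicator fun x => min (G x) N with hHdef
  have hH : ∀ N, Measurable (H N) := fun N =>
    (hG.min measurable_const).indicator (measurableSet_spanningSets μ N)
  have hHG : ∀ N x, H N x ≤ G x := fun N x =>
    Set.indicator_le (fun _ _ => min_le_left _ _) x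
  have htrunc : ∀ N, (∫⁻ x, H N x ^ q ∂μ) ^ (1 / q) ≤ R := by
    intro N
    set I : ℝ≥0∞ := ∫⁻ x, H N x ^ q ∂μ with hI
    have hItop : I ≠ ⊤ := by
      have : I ≤ ∫⁻ x, (spanningSets μ N).indicator (fun _ => (N : ℝ≥0∞) ^ q) x ∂μ := by
        refine lintegral_mono fun x => ?_
        by_cases hx : x ∈ spanningSets μ N
        · simp only [hHdef, Set.indicator_of_mem hx]
          gcongr
          exact min_le_right _ _
        · simp [hHdef, Set.indicator_of_notMem hx, hq0]
      rw [lintegral_indicator_const (measurableSet_spanningSets μ N)] at this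
      refine (this.trans_lt (ENNReal.mul_lt_top ?_ (measure_spanningSets_lt_top μ N))).ne
      exact ENNReal.rpow_lt_top_of_nonneg hq0.le (ENNReal.natCast_ne_top N)
    by_cases hI0 : I = 0
    · simp [hI0, hq0]
    have hc : q.HolderConjugate q.conjExponent := Real.HolderConjugate.conjExponent hq
    have hpow : ∀ x, (H N x ^ (q - 1)) ^ q.conjExponent = H N x ^ q := fun x => by
      rw [← ENNReal.rpow_mul, hc.sub_one_mul_conj]
    have hle : I ≤ I ^ (1 / q.conjExponent) * R := by
      calc I = ∫⁻ x, H N x ^ (q - 1) * H N x ∂μ := by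
            refine lintegral_congr fun x => ?_
            conv_lhs => rw [show q = (q - 1) + 1 by ring]
            rw [ENNReal.rpow_add_of_nonneg _ _ (by linarith) zero_le_one, ENNReal.rpow_one]
        _ ≤ ∫⁻ x, H N x ^ (q - 1) * G x ∂μ := by gcongr with x; exact hHG N x
        _ = ∫⁻ x, ∫⁻ t, H N x ^ (q - 1) * F x t ∂ν ∂μ := by
            refine lintegral_congr fun x => ?_
            exact (lintegral_const_mul _ (hF.comp measurable_prodMk_left)).symm
        _ = ∫⁻ t, ∫⁻ x, H N x ^ (q - 1) * F x t ∂μ ∂ν := by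
            refine lintegral_lintegral_swap (Measurable.aemeasurable ?_)
            exact (((hH N).comp measurable_fst).pow_const _).mul hF
        _ ≤ ∫⁻ t, I ^ (1 / q.conjExponent) * (∫⁻ x, F x t ^ q ∂μ) ^ (1 / q) ∂ν := by
            refine lintegral_mono fun t => ?_
            have := ENNReal.lintegral_mul_le_Lp_mul_Lq μ hc.symm
              (f := fun x => H N x ^ (q - 1)) (g := fun x => F x t)
              ((hH N).pow_const _).aemeasurable (hF.comp measurable_prodMk_right).aemeasurable
            simpa only [hpow, Pi.mul_apply] using this
        _ = I ^ (1 / q.conjExponent) * R := by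
            refine lintegral_const_mul' _ _ ?_
            exact ENNReal.rpow_ne_top_of_nonneg (by simpa using hc.symm.nonneg) hItop
    have hsplit : I = I ^ (1 / q.conjExponent) * I ^ (1 / q) := by
      rw [← ENNReal.rpow_add _ _ hI0 hItop, one_div, one_div, hc.symm.inv_add_inv_eq_one,
        ENNReal.rpow_one]
    rw [hsplit] at hle
    conv_rhs at hle => rw [← hsplit]
    refine (ENNReal.mul_le_mul_iff_right ?_ ?_).1 hle
    · exact (ENNReal.rpow_pos (pos_iff_ne_zero.2 hI0) hItop).ne'
    · exact ENNReal.rpow_ne_top_of_nonneg (by simpa using hc.symm.nonneg) hItop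
  have hlim : Tendsto (fun N => ∫⁻ x, H N x ^ q ∂μ) atTop (𝓝 (∫⁻ x, G x ^ q ∂μ)) := by
    refine lintegral_tendsto_of_tendsto_of_monotone (fun N => ((hH N).pow_const q).aemeasurable)
      (ae_of_all _ fun x N M hNM => ?_) (ae_of_all _ fun x => ?_)
    · refine ENNReal.rpow_le_rpow ?_ hq0.le
      refine (Set.indicator_le_indicator_of_subset (monotone_spanningSets μ hNM)
        (fun _ => zero_le) x).trans (Set.indicator_le_indicator ?_)
      gcongr
    · have h1 : Tendsto (fun N : ℕ => min (G x) (N : ℝ≥0∞)) atTop (𝓝 (G x)) := by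
        simpa using (tendsto_const_nhds (x := G x)).min ENNReal.tendsto_nat_nhds_top
      refine ((ENNReal.continuous_rpow_const (y := q)).tendsto (G x)).comp (h1.congr' ?_)
      filter_upwards [eventually_ge_atTop (spanningSetsIndex μ x)] with N hN
      rw [hHdef]
      simp only
      rw [Set.indicator_of_mem (mem_spanningSets_of_index_le μ x hN)]
  exact le_of_tendsto' (((ENNReal.continuous_rpow_const (y := 1 / q)).tendsto _).comp hlim) htrunc

theorem measurableSet_padicSphere (n : ℕ) (k : ℤ) : MeasurableSet (padicSphere p n k) :=
  measurableSet_eq_fun measurable_norm measurable_const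

instance sigmaFinite_padicHaarPi (n : ℕ) : SigmaFinite (padicHaarPi p n) := by
  unfold padicHaarPi; infer_instance

/-- The Herz norm as an `L^r` norm with respect to counting measure on `ℤ`. -/
theorem herzNorm_eq_lintegral_count (n : ℕ) (α q : ℝ) {r : ℝ} (hr : 0 < r)
    (f : (Fin n → ℚ_[p]) → ℝ≥0∞) :
    herzNorm p n α r q f
      = (∫⁻ k : ℤ, ((p : ℝ≥0∞) ^ ((k : ℝ) * α) * lqNormSphere p n q k f) ^ r ∂Measure.count)
          ^ (1 / r) := by
  rw [herzNorm, lintegral_count]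
  simp_rw [ENNReal.mul_rpow_of_nonneg _ _ hr.le, ← ENNReal.rpow_mul]

theorem measurable_lqNormSphere {T : Type*} [MeasurableSpace T] (n : ℕ) (q : ℝ) (k : ℤ)
    {F : (Fin n → ℚ_[p]) → T → ℝ≥0∞} (hF : Measurable (Function.uncurry F)) :
    Measurable fun t => lqNormSphere p n q k fun x => F x t :=
  ((hF.pow_const q).lintegral_prod_left').pow_const _

theorem natCast_prime_rpow_ne_top (s : ℝ) : (p : ℝ≥0∞) ^ s ≠ ⊤ :=
  ENNReal.rpow_ne_top_of_ne_zero (by exact_mod_cast (Fact.out : p.Prime).ne_zero)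
    (ENNReal.natCast_ne_top p)

theorem prod_natCast_prime_rpow {ι : Type*} (s : Finset ι) (a : ι → ℝ) :
    ∏ i ∈ s, (p : ℝ≥0∞) ^ a i = (p : ℝ≥0∞) ^ ∑ i ∈ s, a i := by
  classical
  induction s using Finset.induction with
  | empty => simp
  | insert i s hi ih =>
    rw [Finset.prod_insert hi, Finset.sum_insert hi, ih,
      ENNReal.rpow_add _ _ (by exact_mod_cast (Fact.out : p.Prime).ne_zero)
        (ENNReal.natCast_ne_top p)]

/-- Minkowski's integral inequality for the Herz norm. -/
theorem herzNorm_lintegral_le {T : Type*} [MeasurableSpace T] (ν : Measure T) [SFinite ν]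
    (n : ℕ) (α : ℝ) {r q : ℝ} (hr : 1 < r) (hq : 1 < q)
    {F : (Fin n → ℚ_[p]) → T → ℝ≥0∞} (hF : Measurable (Function.uncurry F)) :
    herzNorm p n α r q (fun x => ∫⁻ t, F x t ∂ν)
      ≤ ∫⁻ t, herzNorm p n α r q (fun x => F x t) ∂ν := by
  have hr0 : 0 < r := by linarith
  simp_rw [herzNorm_eq_lintegral_count p n α q hr0]
  refine le_trans ?_ (lintegral_rpow_lintegral_le Measure.count ν hr
    (F := fun (k : ℤ) t => (p : ℝ≥0∞) ^ ((k : ℝ) * α) * lqNormSphere p n q k fun x => F x t) ?_)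
  · gcongr with k
    rw [lintegral_const_mul' _ _ (natCast_prime_rpow_ne_top p _)]
    gcongr
    exact lintegral_rpow_lintegral_le _ ν hq hF
  · exact measurable_from_prod_countable_right fun k =>
      (measurable_lqNormSphere p n q k hF).const_mul ((p : ℝ≥0∞) ^ ((k : ℝ) * α))

/-- Hölder's inequality for finitely many functions. -/
theorem lintegral_prod_rpow_le {X ι : Type*} [MeasurableSpace X] [Fintype ι] (μ : Measure X)
    {q : ℝ} {qi : ι → ℝ} (hq : 0 < q) (hqi : ∀ i, 0 < qi i) (hsum : ∑ i, (qi i)⁻¹ = q⁻¹)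
    {g : ι → X → ℝ≥0∞} (hg : ∀ i, Measurable (g i)) :
    (∫⁻ x, (∏ i, g i x) ^ q ∂μ) ^ (1 / q) ≤ ∏ i, (∫⁻ x, g i x ^ qi i ∂μ) ^ (1 / qi i) := by
  have h := ENNReal.lintegral_prod_norm_pow_le (μ := μ) Finset.univ
    (f := fun i x => g i x ^ qi i) (fun i _ => ((hg i).pow_const _).aemeasurable)
    (p := fun i => q / qi i)
    (by simp_rw [div_eq_mul_inv, ← Finset.mul_sum, hsum, mul_inv_cancel₀ hq.ne'])
    (fun i _ => (div_pos hq (hqi i)).le)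
  have h1 : ∀ x, ∏ i, (g i x ^ qi i) ^ (q / qi i) = (∏ i, g i x) ^ q := fun x => by
    rw [← ENNReal.prod_rpow_of_nonneg hq.le]
    refine Finset.prod_congr rfl fun i _ => ?_
    rw [← ENNReal.rpow_mul, mul_div_cancel₀ _ (hqi i).ne']
  simp_rw [h1] at h
  refine (ENNReal.rpow_le_rpow h (by positivity : 0 ≤ 1 / q)).trans_eq ?_
  rw [← ENNReal.prod_rpow_of_nonneg (by positivity)]
  refine Finset.prod_congr rfl fun i _ => ?_
  rw [← ENNReal.rpow_mul]
  congr 1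
  field_simp

/-- Hölder's inequality for the Herz norm. -/
theorem herzNorm_prod_le {ι : Type*} [Fintype ι] (n : ℕ) {α r q : ℝ} {αi ri qi : ι → ℝ}
    (hr : 0 < r) (hq : 0 < q) (hri : ∀ i, 0 < ri i) (hqi : ∀ i, 0 < qi i)
    (hα : ∑ i, αi i = α) (hrsum : ∑ i, (ri i)⁻¹ = r⁻¹) (hqsum : ∑ i, (qi i)⁻¹ = q⁻¹)
    {g : ι → (Fin n → ℚ_[p]) → ℝ≥0∞} (hg : ∀ i, Measurable (g i)) :
    herzNorm p n α r q (fun x => ∏ i, g i x) ≤ ∏ i, herzNorm p n (αi i) (ri i) (qi i) (g i) := by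
  simp_rw [herzNorm_eq_lintegral_count p n _ _ hr, herzNorm_eq_lintegral_count p n _ _ (hri _)]
  refine le_trans ?_ (lintegral_prod_rpow_le Measure.count hr hri hrsum
    (g := fun i (k : ℤ) => (p : ℝ≥0∞) ^ ((k : ℝ) * αi i) * lqNormSphere p n (qi i) k (g i))
    (fun i => measurable_of_countable _))
  gcongr with k
  rw [Finset.prod_mul_distrib]
  have hp : ∏ i, (p : ℝ≥0∞) ^ ((k : ℝ) * αi i) = (p : ℝ≥0∞) ^ ((k : ℝ) * α) := by
    rw [← hα, Finset.mul_sum]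
    exact prod_natCast_prime_rpow p Finset.univ fun i => (k : ℝ) * αi i
  rw [hp]
  gcongr
  exact lintegral_prod_rpow_le _ hq hqi hqsum hg

theorem herzNorm_const_mul (n : ℕ) (α : ℝ) {r q : ℝ} (hr : 0 < r) (hq : 0 < q) (c : ℝ≥0∞)
    {f : (Fin n → ℚ_[p]) → ℝ≥0∞} (hf : Measurable f) :
    herzNorm p n α r q (fun x => c * f x) = c * herzNorm p n α r q f := by
  have hcancel : ∀ {s : ℝ} (_ : 0 < s) (I : ℝ≥0∞), (c ^ s * I) ^ (1 / s) = c * I ^ (1 / s) := by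
    intro s hs I
    rw [ENNReal.mul_rpow_of_nonneg _ _ (by positivity), ← ENNReal.rpow_mul,
      mul_one_div_cancel hs.ne', ENNReal.rpow_one]
  have hlq : ∀ k, lqNormSphere p n q k (fun x => c * f x) = c * lqNormSphere p n q k f := by
    intro k
    rw [lqNormSphere, lqNormSphere, ← hcancel hq, ← lintegral_const_mul _ (hf.pow_const q)]
    simp_rw [ENNReal.mul_rpow_of_nonneg _ _ hq.le]
  rw [herzNorm, herzNorm, ← hcancel hr, ← ENNReal.tsum_mul_left]
  simp_rw [hlq, ENNReal.mul_rpow_of_nonneg _ _ hr.le, mul_left_comm]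

theorem lqNormSphere_comp_smul (n : ℕ) {q : ℝ} (hq : 0 < q) {t : ℚ_[p]} (ht : t ≠ 0) (k : ℤ)
    {f : (Fin n → ℚ_[p]) → ℝ≥0∞} (hf : Measurable f) :
    lqNormSphere p n q k (fun x => f (t • x))
      = (‖t‖₊ : ℝ≥0∞) ^ (-((n : ℝ) / q)) * lqNormSphere p n q (k - t.valuation) f := by
  have hp0 : (p : ℝ) ≠ 0 := by exact_mod_cast (Fact.out : p.Prime).ne_zero
  have hmem : ∀ x : Fin n → ℚ_[p],
      t • x ∈ padicSphere p n (k - t.valuation) ↔ x ∈ padicSphere p n k := by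
    intro x
    rw [padicSphere, padicSphere, Set.mem_ofPred_eq, Set.mem_ofPred_eq, norm_smul,
      Padic.norm_eq_zpow_neg_valuation ht, sub_eq_neg_add, zpow_add₀ hp0]
    exact mul_right_inj' (zpow_ne_zero _ hp0)
  rw [lqNormSphere, lqNormSphere, ← lintegral_indicator (measurableSet_padicSphere p n k),
    ← lintegral_indicator (measurableSet_padicSphere p n _)]
  have hind : ∀ x, (padicSphere p n k).indicator (fun x => f (t • x) ^ q) x
      = (padicSphere p n (k - t.valuation)).indicator (fun x => f x ^ q) (t • x) := by
    intro x
    by_cases hx : x ∈ padicSphere p n k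
    · rw [Set.indicator_of_mem hx, Set.indicator_of_mem ((hmem x).2 hx)]
    · rw [Set.indicator_of_notMem hx, Set.indicator_of_notMem (fun h => hx ((hmem x).1 h))]
  simp_rw [hind]
  rw [lintegral_comp_smul_padicHaarPi p n ht
    ((hf.pow_const q).indicator (measurableSet_padicSphere p n _)),
    ENNReal.mul_rpow_of_nonneg _ _ (by positivity)]
  congr 1
  rw [← ENNReal.rpow_natCast, ← ENNReal.rpow_neg_one, ← ENNReal.rpow_mul, ← ENNReal.rpow_mul]
  congr 1
  ring

theorem herzNorm_comp_smul (n : ℕ) (α : ℝ) {r q : ℝ} (hr : 0 < r) (hq : 0 < q) {t : ℚ_[p]}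
    (ht : t ≠ 0) {f : (Fin n → ℚ_[p]) → ℝ≥0∞} (hf : Measurable f) :
    herzNorm p n α r q (fun x => f (t • x))
      = ENNReal.ofReal ‖t‖ ^ (-(α + (n : ℝ) / q)) * herzNorm p n α r q f := by
  have hp0 : (p : ℝ≥0∞) ≠ 0 := by exact_mod_cast (Fact.out : p.Prime).ne_zero
  have ht0 : (‖t‖₊ : ℝ≥0∞) ≠ 0 := by simpa using ht
  have hnorm : (‖t‖₊ : ℝ≥0∞) = (p : ℝ≥0∞) ^ (-(t.valuation : ℝ)) := by
    rw [← enorm_eq_nnnorm, ← ofReal_norm, Padic.norm_eq_zpow_neg_valuation ht,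
      ← Real.rpow_intCast, ← ENNReal.ofReal_rpow_of_pos
        (by exact_mod_cast (Fact.out : p.Prime).pos), ENNReal.ofReal_natCast]
    push_cast
    rfl
  have hterm : ∀ k : ℤ,
      (p : ℝ≥0∞) ^ ((k : ℝ) * α) * lqNormSphere p n q k (fun x => f (t • x))
        = (‖t‖₊ : ℝ≥0∞) ^ (-(α + (n : ℝ) / q)) * ((p : ℝ≥0∞) ^ (((k - t.valuation : ℤ) : ℝ) * α)
          * lqNormSphere p n q (k - t.valuation) f) := by
    intro k
    rw [lqNormSphere_comp_smul p n hq ht k hf, neg_add,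
      ENNReal.rpow_add _ _ ht0 ENNReal.coe_ne_top]
    have : (p : ℝ≥0∞) ^ ((k : ℝ) * α)
        = (‖t‖₊ : ℝ≥0∞) ^ (-α) * (p : ℝ≥0∞) ^ (((k - t.valuation : ℤ) : ℝ) * α) := by
      rw [hnorm, ← ENNReal.rpow_mul, ← ENNReal.rpow_add _ _ hp0 (ENNReal.natCast_ne_top p)]
      congr 1
      push_cast
      ring
    rw [this]
    ring
  rw [herzNorm_eq_lintegral_count p n α q hr, herzNorm_eq_lintegral_count p n α q hr,
    lintegral_count, lintegral_count, ofReal_norm, enorm_eq_nnnorm]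
  simp_rw [hterm, ENNReal.mul_rpow_of_nonneg _ _ hr.le]
  rw [ENNReal.tsum_mul_left, ENNReal.mul_rpow_of_nonneg _ _ (by positivity : 0 ≤ 1 / r),
    ← ENNReal.rpow_mul (_ ^ _) r, mul_one_div_cancel hr.ne', ENNReal.rpow_one]
  congr 2
  exact (Equiv.subRight t.valuation).tsum_eq fun k : ℤ =>
    ((p : ℝ≥0∞) ^ ((k : ℝ) * α)) ^ r * lqNormSphere p n q k f ^ r

theorem measurableSet_ZpstarPi (m : ℕ) : MeasurableSet (ZpstarPi p m) := by
  refine MeasurableSet.univ_pi fun _ => ?_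
  exact (measurableSet_singleton (0 : ℚ_[p])).compl.inter
    (measurableSet_le measurable_norm measurable_const)

/-- Boundedness of the weighted multilinear `p`-adic Hardy operator on products of Herz spaces. -/
theorem herzNorm_multilinearHardy_le (n m : ℕ) {α r q : ℝ} {αi ri qi : Fin m → ℝ}
    (hr : 1 < r) (hq : 1 < q) (hri : ∀ i, 1 < ri i) (hqi : ∀ i, 1 < qi i)
    (hα : ∑ i, αi i = α) (hrsum : ∑ i, (ri i)⁻¹ = r⁻¹) (hqsum : ∑ i, (qi i)⁻¹ = q⁻¹)
    {ψ : (Fin m → ℚ_[p]) → ℝ≥0∞} (hψ : Measurable ψ)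
    {f : Fin m → (Fin n → ℚ_[p]) → ℝ≥0∞} (hf : ∀ i, Measurable (f i)) :
    herzNorm p n α r q (multilinearHardy p n m ψ f)
      ≤ (∫⁻ t in ZpstarPi p m,
          (∏ i, ENNReal.ofReal ‖t i‖ ^ (-(αi i + (n : ℝ) / qi i))) * ψ t ∂padicHaarPi p m)
        * ∏ i, herzNorm p n (αi i) (ri i) (qi i) (f i) := by
  have hmeas : Measurable (Function.uncurry fun (x : Fin n → ℚ_[p]) (t : Fin m → ℚ_[p]) =>
      (∏ i, f i (t i • x)) * ψ t) := by
    refine Measurable.mul (Finset.measurable_fun_prod _ fun i _ => (hf i).comp ?_)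
      (hψ.comp measurable_snd)
    exact ((measurable_pi_apply i).comp measurable_snd).smul measurable_fst
  have hw : Measurable fun t : Fin m → ℚ_[p] =>
      (∏ i, ENNReal.ofReal ‖t i‖ ^ (-(αi i + (n : ℝ) / qi i))) * ψ t := by
    refine Measurable.mul (Finset.measurable_fun_prod _ fun i _ => ?_) hψ
    exact (measurable_pi_apply i).norm.ennreal_ofReal.pow_const _
  refine (herzNorm_lintegral_le p _ n α hr hq hmeas).trans ?_
  rw [← lintegral_mul_const _ hw]
  refine setLIntegral_mono (hw.mul_const _) fun t ht => ?_
  have hsmul : ∀ i, Measurable fun x : Fin n → ℚ_[p] => f i (t i • x) := fun i =>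
    (hf i).comp (measurable_const_smul (t i))
  have hH := herzNorm_prod_le p n (by linarith) (by linarith) (fun i => by linarith [hri i])
    (fun i => by linarith [hqi i]) hα hrsum hqsum hsmul
  simp_rw [mul_comm _ (ψ t)]
  rw [herzNorm_const_mul p n α (by linarith) (by linarith) (ψ t)
    (Finset.measurable_fun_prod _ fun i _ => hsmul i), mul_assoc, ← Finset.prod_mul_distrib]
  gcongr
  refine hH.trans_eq (Finset.prod_congr rfl fun i _ => ?_)
  exact herzNorm_comp_smul p n (αi i) (by linarith [hri i]) (by linarith [hqi i])
    (ht i (Set.mem_univ i)).1 (hf i)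

/-- Sufficiency part of Theorem 2.1: if the weight integral `A` is finite, then the
weighted multilinear p-adic Hardy operator is bounded on the product of Herz spaces,
with operator norm at most `A`. -/
theorem statement0 (p n m : ℕ) [Fact p.Prime] (hn : 1 ≤ n) (hm : 1 ≤ m)
    (α : ℝ) (αi : Fin m → ℝ) (r q : ℝ) (ri qi : Fin m → ℝ)
    (hr : 1 < r) (hq : 1 < q) (hri : ∀ i, 1 < ri i) (hqi : ∀ i, 1 < qi i)
    (hα : ∑ i, αi i = α) (hrsum : ∑ i, (ri i)⁻¹ = r⁻¹) (hqsum : ∑ i, (qi i)⁻¹ = q⁻¹)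
    (ψ : (Fin m → ℚ_[p]) → ℝ≥0∞) (hψ : Measurable ψ)
    (A : ℝ≥0∞)
    (hA : A = ∫⁻ t in ZpstarPi p m,
        (∏ i, ENNReal.ofReal ‖t i‖ ^ (-(αi i + (n : ℝ) / qi i))) * ψ t ∂ padicHaarPi p m)
    (hAfin : A ≠ ⊤) :
    (∀ f : Fin m → (Fin n → ℚ_[p]) → ℝ≥0∞, (∀ i, Measurable (f i)) →
        herzNorm p n α r q (multilinearHardy p n m ψ f)
          ≤ A * ∏ i, herzNorm p n (αi i) (ri i) (qi i) (f i)) ∧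
      sInf {C : ℝ≥0∞ | ∀ f : Fin m → (Fin n → ℚ_[p]) → ℝ≥0∞, (∀ i, Measurable (f i)) →
        herzNorm p n α r q (multilinearHardy p n m ψ f)
          ≤ C * ∏ i, herzNorm p n (αi i) (ri i) (qi i) (f i)} ≤ A := by
  have key := fun (f : Fin m → (Fin n → ℚ_[p]) → ℝ≥0∞) (hf : ∀ i, Measurable (f i)) =>
    herzNorm_multilinearHardy_le p n m hr hq hri hqi hα hrsum hqsum hψ hf
  rw [← hA] at key
  exact ⟨key, sInf_le key⟩

end
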